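/- Let A be a finite type with binary operations ⋆, ⊓ and unary operations d, r, let θ be a representation of A by partial functions on X and θ' a representation on X'. Let x ∈ X and α ∈ A with α labelling (x,x) in θ, and x' ∈ X' and β ∈ A with β labelling (x',x') in θ'. Suppose there exist a, b ∈ A with d(a) = α, r(a) = β, d(b) = β and r(b) = α. Then there is a bijection φ from the present of x (with respect to θ) to the present of x' (with respect to θ') such that for all y, z in the present of x and all c ∈ A, (y,z) ∈ θ(c) ↔ (φ(y), φ(z)) ∈ θ'(c). -/

import Mathlib

universe u v w

/-- A set of pairs is functional (is a partial function). -/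
def Functional {X : Type u} (f : Set (X × X)) : Prop :=
  ∀ x y y' : X, (x, y) ∈ f → (x, y') ∈ f → y = y'

/-- Composition of partial functions (left-to-right). -/
def pComp {X : Type u} (f g : Set (X × X)) : Set (X × X) :=
  {p | ∃ y, (p.1, y) ∈ f ∧ (y, p.2) ∈ g}

/-- Diagonal of the domain. -/
def pDom {X : Type u} (f : Set (X × X)) : Set (X × X) :=
  {p | p.1 = p.2 ∧ ∃ y, (p.1, y) ∈ f}

/-- Diagonal of the range. -/
def pRan {X : Type u} (f : Set (X × X)) : Set (X × X) :=
  {p | p.1 = p.2 ∧ ∃ x, (x, p.2) ∈ f}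

/-- The identity function on `X`. -/
def pId (X : Type u) : Set (X × X) := {p | p.1 = p.2}

/-- Diagonal of the antidomain. -/
def pAnti {X : Type u} (f : Set (X × X)) : Set (X × X) :=
  {p | p.1 = p.2 ∧ ¬∃ y, (p.1, y) ∈ f}

/-- Fixset: diagonal of the fixed points. -/
def pFix {X : Type u} (f : Set (X × X)) : Set (X × X) :=
  {p | p.1 = p.2 ∧ (p.1, p.1) ∈ f}

/-- Preferential union. -/
def pPref {X : Type u} (f g : Set (X × X)) : Set (X × X) :=
  f ∪ {p | p ∈ g ∧ ¬∃ z, (p.1, z) ∈ f}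

/-- Iterated composition: `pPow f 0 = pId X`, `pPow f (n+1) = f ∘ pPow f n`. -/
def pPow {X : Type u} (f : Set (X × X)) : ℕ → Set (X × X)
  | 0 => pId X
  | n + 1 => pComp f (pPow f n)

/-- Maximum iterate. -/
def pMaxIter {X : Type u} (f : Set (X × X)) : Set (X × X) :=
  ⋃ n : ℕ, pComp (pPow f n) (pAnti f)

/-- Opposite (bilateral inverse). -/
def pOpp {X : Type u} (f : Set (X × X)) : Set (X × X) :=
  {p | (p.2, p.1) ∈ f ∧ ∀ x', (x', p.1) ∈ f → x' = p.2}

/-- Unique-preimage operation. -/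
def pU {X : Type u} (f : Set (X × X)) : Set (X × X) :=
  {p | p.1 = p.2 ∧ ∃! x, (x, p.2) ∈ f}

/-- The future of a vertex `x` with respect to `θ`. -/
def future {A : Type*} {X : Type u} (θ : A → Set (X × X)) (x : X) : Set X :=
  {y | ∃ b : A, (x, y) ∈ θ b}

/-- The present of a vertex `x` with respect to `θ`. -/
def present {A : Type*} {X : Type u} (θ : A → Set (X × X)) (x : X) : Set X :=
  {y | y ∈ future θ x ∧ x ∈ future θ y}

/-- `a` labels the edge `(x, y)`: `a` holds there and is least among elements holding there. -/
def Labels {A : Type*} {X : Type u} (meet : A → A → A) (θ : A → Set (X × X))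
    (a : A) (x y : X) : Prop :=
  (x, y) ∈ θ a ∧ ∀ b : A, (x, y) ∈ θ b → meet a b = a

/-- Representation for the signature {composition, intersection, domain, range}. -/
def IsRepDR {A : Type*} {X : Type u} (star meet : A → A → A) (d r : A → A)
    (θ : A → Set (X × X)) : Prop :=
  Function.Injective θ ∧ (∀ a, Functional (θ a)) ∧
  (∀ a b, θ (star a b) = pComp (θ a) (θ b)) ∧
  (∀ a b, θ (meet a b) = θ a ∩ θ b) ∧
  (∀ a, θ (d a) = pDom (θ a)) ∧
  (∀ a, θ (r a) = pRan (θ a))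

namespace IsRepDR

variable {A : Type*} {X : Type u} {X' : Type v} {star meet : A → A → A} {d r : A → A}
  {θ : A → Set (X × X)} {θ' : A → Set (X' × X')}

theorem functional (h : IsRepDR star meet d r θ) {a : A} {x y z : X}
    (h₁ : (x, y) ∈ θ a) (h₂ : (x, z) ∈ θ a) : y = z :=
  h.2.1 a x y z h₁ h₂

theorem mem_star (h : IsRepDR star meet d r θ) {a b : A} {x z : X} :
    (x, z) ∈ θ (star a b) ↔ ∃ y, (x, y) ∈ θ a ∧ (y, z) ∈ θ b := by
  rw [h.2.2.1]; rfl

theorem mem_meet (h : IsRepDR star meet d r θ) {a b : A} {x y : X} :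
    (x, y) ∈ θ (meet a b) ↔ (x, y) ∈ θ a ∧ (x, y) ∈ θ b := by
  rw [h.2.2.2.1]; rfl

theorem mem_d (h : IsRepDR star meet d r θ) {a : A} {x y : X} :
    (x, y) ∈ θ (d a) ↔ x = y ∧ ∃ z, (x, z) ∈ θ a := by
  rw [h.2.2.2.2.1]; rfl

theorem mem_r (h : IsRepDR star meet d r θ) {a : A} {x y : X} :
    (x, y) ∈ θ (r a) ↔ x = y ∧ ∃ z, (z, y) ∈ θ a := by
  rw [h.2.2.2.2.2]; rfl

theorem ext (h : IsRepDR star meet d r θ) {a b : A}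
    (hab : ∀ x y, (x, y) ∈ θ a ↔ (x, y) ∈ θ b) : a = b :=
  h.1 (Set.ext fun p => hab p.1 p.2)

theorem star_assoc (h : IsRepDR star meet d r θ) (a b c : A) :
    star (star a b) c = star a (star b c) := by
  refine h.ext fun x y => ?_
  simp only [h.mem_star]
  constructor
  · rintro ⟨v, ⟨u, h₁, h₂⟩, h₃⟩
    exact ⟨u, h₁, v, h₂, h₃⟩
  · rintro ⟨u, h₁, v, h₂, h₃⟩
    exact ⟨v, ⟨u, h₁, h₂⟩, h₃⟩

theorem d_star (h : IsRepDR star meet d r θ) (a : A) : star (d a) a = a := by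
  refine h.ext fun x y => ?_
  simp only [h.mem_star, h.mem_d]
  constructor
  · rintro ⟨_, ⟨rfl, -⟩, hy⟩
    exact hy
  · exact fun hy => ⟨x, ⟨rfl, y, hy⟩, hy⟩

theorem star_r (h : IsRepDR star meet d r θ) (a : A) : star a (r a) = a := by
  refine h.ext fun x y => ?_
  simp only [h.mem_star, h.mem_r]
  constructor
  · rintro ⟨_, hy, rfl, -⟩
    exact hy
  · exact fun hy => ⟨y, hy, rfl, x, hy⟩

theorem r_star_r (h : IsRepDR star meet d r θ) (a : A) : star (r a) (r a) = r a := by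
  refine h.ext fun x y => ?_
  simp only [h.mem_star, h.mem_r]
  constructor
  · rintro ⟨_, ⟨rfl, -⟩, hy⟩
    exact hy
  · exact fun hy => ⟨y, hy, rfl, hy.2⟩

theorem r_star_eq_of_star_eq (h : IsRepDR star meet d r θ) {a b c : A}
    (hbc : star a b = star a c) :
    star (r a) b = star (r a) c := by
  have key : ∀ {b c : A}, star a b = star a c → ∀ {x y},
      (x, y) ∈ θ (star (r a) b) → (x, y) ∈ θ (star (r a) c) := by
    intro b c hbc x y hxy
    obtain ⟨x', hx, hb⟩ := h.mem_star.1 hxy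
    obtain ⟨rfl, z, hz⟩ := h.mem_r.1 hx
    obtain ⟨w, hw, hwy⟩ := h.mem_star.1 (hbc ▸ h.mem_star.2 ⟨x, hz, hb⟩)
    obtain rfl := h.functional hz hw
    exact h.mem_star.2 ⟨x, hx, hwy⟩
  exact h.ext fun x y => ⟨key hbc, key hbc.symm⟩

/-- In a finite algebra, elements `a`, `b` going back and forth between two domain elements
can be improved to a pair of mutually inverse ones. -/
theorem exists_inverse (h : IsRepDR star meet d r θ) [Finite A] {a b : A}
    (hab : r a = d b) (hba : r b = d a) :
    ∃ b', star a b' = d a ∧ star b' a = r a ∧ star b' (d a) = b' := by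
  let S := {q : A // star (d a) q = q}
  let T : S → S := fun q => ⟨star a (star b q), by
    rw [← h.star_assoc, h.d_star]⟩
  have hT : Function.Injective T := by
    intro q q' hq
    have h₁ := h.r_star_eq_of_star_eq (congrArg Subtype.val hq)
    rw [hab, ← h.star_assoc, ← h.star_assoc, h.d_star] at h₁
    have h₂ := h.r_star_eq_of_star_eq h₁
    rw [hba, q.2, q'.2] at h₂
    exact Subtype.ext h₂
  obtain ⟨q, hq⟩ := (Finite.injective_iff_surjective.1 hT)
    ⟨d a, by rw [← hba, h.r_star_r]⟩
  have h₁ : star a (star b q) = d a := congrArg Subtype.val hq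
  have h₂ : star (r a) (star b q) = star b q := by
    rw [hab, ← h.star_assoc, h.d_star]
  have h₃ : star (star b q) a = r a := by
    have : star a (star (star b q) a) = star a (r a) := by
      rw [← h.star_assoc, h₁, h.d_star, h.star_r]
    have := h.r_star_eq_of_star_eq this
    rwa [← h.star_assoc, h₂, h.r_star_r] at this
  exact ⟨star b q, h₁, h₃,
    (congrArg (star (star b q)) h₁).symm.trans (by rw [← h.star_assoc, h₃, h₂])⟩

/-- Elements agreeing at one edge from `x` agree on the whole of the label of `(x, x)`. -/
theorem label_star_eq (h : IsRepDR star meet d r θ) {x y : X} {α f g : A}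
    (hα : Labels meet θ α x x)
    (hf : (x, y) ∈ θ f) (hg : (x, y) ∈ θ g) : star α f = star α g := by
  have hd := hα.2 _ (h.mem_d.2 ⟨rfl, y, h.mem_meet.2 ⟨hf, hg⟩⟩)
  refine h.ext fun u v => ?_
  simp only [h.mem_star]
  refine exists_congr fun w => and_congr_right fun hw => ?_
  rw [← hd] at hw
  obtain ⟨rfl, z, hz⟩ := h.mem_d.1 (h.mem_meet.1 hw).2
  obtain ⟨hzf, hzg⟩ := h.mem_meet.1 hz
  constructor
  · intro huv
    rwa [h.functional huv hzf]
  · intro huv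
    rwa [h.functional huv hzg]

variable {x y z : X} {x' y' z' : X'} {α β a b c e f : A}

/-- Moving a vertex of the present of `x` to the present of `x'`. -/
theorem exists_mem_present (h : IsRepDR star meet d r θ) (h' : IsRepDR star meet d r θ')
    (hα : Labels meet θ α x x) (hβ : (x', x') ∈ θ' β)
    (hαα : star α α = α) (hba : star b a = β) (hbα : star b α = b)
    (hy : y ∈ present θ x) (hc : (x, y) ∈ θ c) :
    ∃ y' ∈ present θ' x', (x', y') ∈ θ' (star b c) := by
  obtain ⟨e, he⟩ := hy.2
  have hce : star b (star (star c e) a) = β := by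
    have := h.label_star_eq hα (h.mem_star.2 ⟨y, hc, he⟩) hα.1
    rw [← h.star_assoc, ← hbα, h.star_assoc b α (star c e), this, hαα, hbα, hba]
  have hx' : (x', x') ∈ θ' (star (star b c) (star e a)) := by
    rwa [h.star_assoc, ← h.star_assoc c, hce]
  obtain ⟨y', hy', hey'⟩ := h'.mem_star.1 hx'
  exact ⟨y', ⟨⟨_, hy'⟩, _, hey'⟩, hy'⟩

/-- Edges between vertices of the present of `x` move to the present of `x'`. -/
theorem mem_of_mem (h : IsRepDR star meet d r θ) (h' : IsRepDR star meet d r θ')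
    (hα : Labels meet θ α x x) (hbα : star b α = b)
    (hy : (x, y) ∈ θ c) (hz : (x, z) ∈ θ e)
    (hy' : (x', y') ∈ θ' (star b c)) (hz' : (x', z') ∈ θ' (star b e))
    (hyz : (y, z) ∈ θ f) : (y', z') ∈ θ' f := by
  have key := h.label_star_eq hα hz (h.mem_star.2 ⟨y, hy, hyz⟩)
  have hbe : star b e = star (star b c) f := by
    rw [h.star_assoc, ← hbα, h.star_assoc, key, ← h.star_assoc]
  rw [hbe] at hz'
  obtain ⟨w, hw, hwz⟩ := h'.mem_star.1 hz'
  rwa [h'.functional hy' hw]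

end IsRepDR

/-- Equivalent realisable domain elements have isomorphic presents. -/
theorem equivalent_isomorphic_presents {A : Type*} [Fintype A] {X : Type u} {X' : Type v}
    (star meet : A → A → A) (d r : A → A)
    (θ : A → Set (X × X)) (θ' : A → Set (X' × X'))
    (hθ : IsRepDR star meet d r θ) (hθ' : IsRepDR star meet d r θ')
    (x : X) (α : A) (hα : Labels meet θ α x x)
    (x' : X') (β : A) (hβ : Labels meet θ' β x' x')
    (hab : ∃ a : A, d a = α ∧ r a = β) (hba : ∃ b : A, d b = β ∧ r b = α) :
    ∃ φ : present θ x → present θ' x', Function.Bijective φ ∧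
      ∀ (y z : present θ x) (c : A),
        ((y : X), (z : X)) ∈ θ c ↔ ((φ y : X'), (φ z : X')) ∈ θ' c := by
  obtain ⟨a, rfl, rfl⟩ := hab
  obtain ⟨b₀, hdb, hrb⟩ := hba
  obtain ⟨b, hab, hba, hbα⟩ := hθ.exists_inverse hdb.symm hrb
  have hαα : star (d a) (d a) = d a := by rw [← hrb, hθ.r_star_r]
  have hx : (x, x) ∈ θ (d a) := hα.1
  choose c hc using fun y : present θ x => y.2.1
  choose g hg hgc using fun y : present θ x =>
    hθ.exists_mem_present hθ' hα hβ.1 hαα hba hbα y.2 (hc y)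
  have back (y : present θ x) : (x, (y : X)) ∈ θ (star a (star b (c y))) := by
    rw [← hθ.star_assoc, hab]
    exact hθ.mem_star.2 ⟨x, hx, hc y⟩
  have iso (y z : present θ x) (f : A) : ((y : X), (z : X)) ∈ θ f ↔ (g y, g z) ∈ θ' f :=
    ⟨hθ.mem_of_mem hθ' hα hbα (hc y) (hc z) (hgc y) (hgc z),
      hθ'.mem_of_mem hθ hβ (hθ.star_r a) (hgc y) (hgc z) (back y) (back z)⟩
  refine ⟨fun y => ⟨g y, hg y⟩, ⟨fun y z hyz => ?_, fun y' => ?_⟩, iso⟩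
  · have hyy := (iso y y _).1 (hθ.mem_r.2 ⟨rfl, x, hc y⟩)
    have hg_eq : g y = g z := congrArg Subtype.val hyz
    nth_rewrite 2 [hg_eq] at hyy
    exact Subtype.ext (hθ.mem_r.1 ((iso y z _).2 hyy)).1
  · obtain ⟨c', hc'⟩ := y'.2.1
    obtain ⟨y, hy, hyc⟩ := hθ'.exists_mem_present hθ hβ hx (hθ.r_star_r a) hab
      (hθ.star_r a) y'.2 hc'
    refine ⟨⟨y, hy⟩, Subtype.ext (hθ'.functional (hgc ⟨y, hy⟩) ?_)⟩
    have key := hθ.label_star_eq hα (hc ⟨y, hy⟩) hyc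
    rw [← hbα, hθ.star_assoc, key, ← hθ.star_assoc, hbα, ← hθ.star_assoc, hba]
    exact hθ'.mem_star.2 ⟨x', hβ.1, hc'⟩
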